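/- There exist a shift-invariant ergodic Borel probability measure μ on {0,1}^ℕ and a sequence of strictly positive reals (α_m)_{m≥1} such that: (A) (1/m)·log α_m → 0 as m → ∞; (B) μ[1^m] ≥ α_m for every m ≥ 1, where 1^m is the all-ones word of length m; and (C) the Shannon entropy rate of μ exists and exceeds 1/2·log 2 when entropy is measured in bits (equivalently, lim_n (1/n)·(−∑_{w∈{0,1}^n} μ[w]·log₂ μ[w]) exists and is > 1/2). -/

import Mathlib

open MeasureTheory Filter Topology

/-- The left shift on one-sided sequences. -/
def shift {𝒜 : Type} (x : ℕ → 𝒜) : ℕ → 𝒜 := fun n => x (n + 1)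

/-- The measure of the cylinder set determined by a finite word `w`. -/
noncomputable def cylMeas {𝒜 : Type} [MeasurableSpace 𝒜] (μ : Measure (ℕ → 𝒜)) {n : ℕ}
    (w : Fin n → 𝒜) : ℝ :=
  (μ {x : ℕ → 𝒜 | ∀ i : Fin n, x i.val = w i}).toReal

open ProbabilityTheory Real

section Ergodicity

variable {E F : Type} [MeasurableSpace E] [MeasurableSpace F]

lemma measurable_shift : Measurable (shift : (ℕ → E) → ℕ → E) :=
  measurable_pi_lambda _ fun n => measurable_pi_apply (n + 1)

/-- The shift preserves the law of an i.i.d. sequence. -/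
lemma measurePreserving_shift_infinitePi (ν : Measure E) [IsProbabilityMeasure ν] :
    MeasurePreserving shift (Measure.infinitePi fun _ : ℕ => ν)
      (Measure.infinitePi fun _ : ℕ => ν) := by
  refine ⟨measurable_shift, Measure.eq_infinitePi _ fun s t ht => ?_⟩
  rw [Measure.map_apply measurable_shift (.pi s.countable_toSet fun i _ => ht i)]
  have h : shift ⁻¹' (Set.pi s t) =
      Set.pi (s.map (addRightEmbedding 1) : Finset ℕ) fun i => t (i - 1) := by
    ext x
    simp [shift, Set.mem_pi]
  rw [h, Measure.infinitePi_pi _ fun i _ => ht _]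
  simp

/-- The pairs of coordinates of two independent i.i.d. sequences are independent. -/
lemma iIndep_comap_coord_prod (ν : Measure E) (β : Measure F) [IsProbabilityMeasure ν]
    [IsProbabilityMeasure β] :
    iIndep (fun n : ℕ => MeasurableSpace.comap
        (fun p : (ℕ → E) × (ℕ → F) => (p.1 n, p.2 n)) inferInstance)
      ((Measure.infinitePi fun _ : ℕ => ν).prod (Measure.infinitePi fun _ : ℕ => β)) := by
  have hmeas : ∀ n : ℕ, Measurable fun p : (ℕ → E) × (ℕ → F) => (p.1 n, p.2 n) :=
    fun n => by fun_prop
  refine iIndepSets.iIndep (fun n => (hmeas n).comap_le)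
    (fun n => Set.preimage (fun p : (ℕ → E) × (ℕ → F) => (p.1 n, p.2 n)) ''
      (Set.image2 (· ×ˢ ·) {s | MeasurableSet s} {t | MeasurableSet t}))
    (fun n => IsPiSystem.comap isPiSystem_prod _)
    (fun n => by rw [← MeasurableSpace.comap_generateFrom, generateFrom_prod]) ?_
  rw [iIndepSets_iff]
  intro s f hf
  have hf' : ∀ i, ∃ A : Set E, ∃ B : Set F, MeasurableSet A ∧ MeasurableSet B ∧
      (i ∈ s → f i = (Function.eval i ⁻¹' A) ×ˢ (Function.eval i ⁻¹' B)) := by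
    intro i
    by_cases hi : i ∈ s
    · obtain ⟨_, ⟨A, hA, B, hB, rfl⟩, h⟩ := hf i hi
      exact ⟨A, B, hA, hB, fun _ => h ▸ rfl⟩
    · exact ⟨∅, ∅, .empty, .empty, fun h => absurd h hi⟩
  choose A B hA hB hfAB using hf'
  have h1 : ⋂ i ∈ s, f i = (Set.pi s A) ×ˢ (Set.pi s B) := by
    ext p
    simp only [Set.mem_iInter, Set.mem_prod, Set.mem_pi, SetLike.mem_coe]
    constructor
    · intro h
      exact ⟨fun i hi => ((hfAB i hi) ▸ h i hi).1, fun i hi => ((hfAB i hi) ▸ h i hi).2⟩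
    · intro h i hi
      rw [hfAB i hi]
      exact ⟨h.1 i hi, h.2 i hi⟩
  rw [h1, Measure.prod_prod, Measure.infinitePi_pi _ fun i _ => hA i,
    Measure.infinitePi_pi _ fun i _ => hB i, ← Finset.prod_mul_distrib]
  refine Finset.prod_congr rfl fun i hi => ?_
  rw [hfAB i hi, Measure.prod_prod,
    (measurePreserving_eval_infinitePi (fun _ : ℕ => ν) i).measure_preimage
      (hA i).nullMeasurableSet,
    (measurePreserving_eval_infinitePi (fun _ : ℕ => β) i).measure_preimage
      (hB i).nullMeasurableSet]

/-- By Kolmogorov's zero-one law, the shift on a pair of independent i.i.d. sequences is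
ergodic. -/
lemma ergodic_prodMap_shift_infinitePi (ν : Measure E) (β : Measure F) [IsProbabilityMeasure ν]
    [IsProbabilityMeasure β] :
    Ergodic (Prod.map shift shift)
      ((Measure.infinitePi fun _ : ℕ => ν).prod (Measure.infinitePi fun _ : ℕ => β)) := by
  refine ⟨(measurePreserving_shift_infinitePi ν).prod (measurePreserving_shift_infinitePi β),
    ⟨fun s hs hinv => ?_⟩⟩
  set m : ℕ → MeasurableSpace ((ℕ → E) × (ℕ → F)) := fun n => MeasurableSpace.comap
    (fun p : (ℕ → E) × (ℕ → F) => (p.1 n, p.2 n)) inferInstance with hm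
  have hiter : ∀ n : ℕ, (Prod.map shift shift)^[n] =
      fun p : (ℕ → E) × (ℕ → F) => (fun i => p.1 (i + n), fun i => p.2 (i + n)) := by
    intro n
    induction n with
    | zero => rfl
    | succ n ih =>
      rw [Function.iterate_succ, ih]
      funext p
      simp [shift, add_assoc]
  have htail : MeasurableSet[limsup m atTop] s := by
    rw [limsup_eq_iInf_iSup_of_nat, MeasurableSpace.measurableSet_iInf]
    intro n
    rw [← Function.IsFixedPt.preimage_iterate hinv n, hiter]
    have hpair : ∀ i, Measurable[⨆ k ≥ n, m k]
        fun p : (ℕ → E) × (ℕ → F) => (p.1 (i + n), p.2 (i + n)) := fun i =>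
      (comap_measurable _).mono (le_iSup₂_of_le (f := fun k (_ : k ≥ n) => m k) (i + n)
        (Nat.le_add_left n i) le_rfl) le_rfl
    refine Measurable.prodMk (m := ⨆ k ≥ n, m k) ?_ ?_ hs
    · exact @measurable_pi_lambda _ _ _ (⨆ k ≥ n, m k) _ _ fun i => measurable_fst.comp (hpair i)
    · exact @measurable_pi_lambda _ _ _ (⨆ k ≥ n, m k) _ _ fun i => measurable_snd.comp (hpair i)
  have h01 := measure_zero_or_one_of_measurableSet_limsup_atTop
    (fun n => Measurable.comap_le (by fun_prop)) (iIndep_comap_coord_prod ν β) htail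
  rw [eventuallyConst_set']
  rcases h01 with h | h
  · exact Or.inl (ae_eq_empty.2 h)
  · exact Or.inr (ae_eq_univ.2 ((prob_compl_eq_zero_iff hs).2 h))

end Ergodicity

section Entropy

/-- The Shannon entropy, in nats, of the first `n` symbols. -/
noncomputable def blockEntropy (μ : Measure (ℕ → Bool)) (n : ℕ) : ℝ :=
  ∑ w : Fin n → Bool, negMulLog (cylMeas μ w)

lemma negMulLog_le_of_mul {p a b : ℝ} (hp : 0 ≤ p) (ha : p ≤ a) (hb : p ≤ b) :
    negMulLog p ≤ -(p * log a) - p * log b + (a * b - p) := by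
  rcases hp.eq_or_lt with rfl | hp
  · simpa using mul_nonneg ha hb
  have ha' := hp.trans_le ha
  have hb' := hp.trans_le hb
  have h := mul_le_mul_of_nonneg_left (log_le_sub_one_of_pos (div_pos (mul_pos ha' hb') hp)) hp.le
  rw [log_div (mul_pos ha' hb').ne' hp.ne', log_mul ha'.ne' hb'.ne'] at h
  have h2 : p * (a * b / p - 1) = a * b - p := by field_simp
  rw [h2] at h
  simp only [negMulLog]
  linarith

/-- Subadditivity of entropy for a joint distribution `p` with marginals `a` and `b`. -/
lemma sum_negMulLog_le_add {ι κ : Type*} [Fintype ι] [Fintype κ] {p : ι × κ → ℝ} {a : ι → ℝ}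
    {b : κ → ℝ} (hp : ∀ x, 0 ≤ p x) (ha : ∀ i, ∑ j, p (i, j) = a i)
    (hb : ∀ j, ∑ i, p (i, j) = b j) (ha1 : ∑ i, a i = 1) (hb1 : ∑ j, b j = 1) :
    ∑ x, negMulLog (p x) ≤ ∑ i, negMulLog (a i) + ∑ j, negMulLog (b j) := by
  have h1 : ∑ i, ∑ j, p (i, j) * log (a i) = ∑ i, a i * log (a i) := by
    simp_rw [← Finset.sum_mul, ha]
  have h2 : ∑ i, ∑ j, p (i, j) * log (b j) = ∑ j, b j * log (b j) := by
    rw [Finset.sum_comm]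
    simp_rw [← Finset.sum_mul, hb]
  have h3 : ∑ i, ∑ j, a i * b j = 1 := by
    simp_rw [← Finset.mul_sum, hb1, mul_one, ha1]
  have h4 : ∑ i, ∑ j, p (i, j) = 1 := by simp_rw [ha, ha1]
  calc ∑ x, negMulLog (p x)
      ≤ ∑ x : ι × κ, (-(p x * log (a x.1)) - p x * log (b x.2) + (a x.1 * b x.2 - p x)) := by
        refine Finset.sum_le_sum fun x _ => negMulLog_le_of_mul (hp x) ?_ ?_
        · rw [← ha]
          exact Finset.single_le_sum (f := fun j => p (x.1, j)) (fun _ _ => hp _)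
            (Finset.mem_univ x.2)
        · rw [← hb]
          exact Finset.single_le_sum (f := fun i => p (i, x.2)) (fun _ _ => hp _)
            (Finset.mem_univ x.1)
    _ = _ := by
        rw [Fintype.sum_prod_type]
        simp only [Finset.sum_add_distrib, Finset.sum_sub_distrib, Finset.sum_neg_distrib, h1, h2,
          h3, h4, negMulLog, neg_mul]
        ring

variable {μ : Measure (ℕ → Bool)}

lemma measurableSet_cylinder_word {n : ℕ} (w : Fin n → Bool) :
    MeasurableSet {x : ℕ → Bool | ∀ i : Fin n, x i.val = w i} := by
  refine MeasurableSet.congr (MeasurableSet.iInter fun i : Fin n =>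
    measurable_pi_apply (X := fun _ : ℕ => Bool) i.val (measurableSet_singleton (w i))) ?_
  ext x
  simp

/-- The words of length `n` partition any event. -/
lemma sum_measureReal_inter_cylinder [IsProbabilityMeasure μ] (n : ℕ) {f : (ℕ → Bool) → ℕ → Bool}
    (hf : Measurable f) (s : Set (ℕ → Bool)) :
    ∑ w : Fin n → Bool, μ.real (s ∩ f ⁻¹' {x | ∀ i : Fin n, x i.val = w i}) = μ.real s := by
  have hm : Measurable fun (x : ℕ → Bool) (i : Fin n) => f x i.val := by fun_prop
  have hset : ∀ w : Fin n → Bool, s ∩ f ⁻¹' {x | ∀ i : Fin n, x i.val = w i} =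
      s ∩ (fun (x : ℕ → Bool) (i : Fin n) => f x i.val) ⁻¹' {w} := by
    intro w
    ext x
    simp [funext_iff]
  simp_rw [hset]
  have h := sum_measureReal_preimage_singleton (μ := μ.restrict s)
    (f := fun (x : ℕ → Bool) (i : Fin n) => f x i.val) Finset.univ
    (fun w _ => hm (measurableSet_singleton w))
  simp only [Finset.coe_univ, Set.preimage_univ, measureReal_restrict_apply_univ] at h
  rw [← h]
  refine Finset.sum_congr rfl fun w _ => ?_
  rw [measureReal_restrict_apply (hm (measurableSet_singleton w)), Set.inter_comm]

lemma sum_cylMeas [IsProbabilityMeasure μ] (n : ℕ) : ∑ w : Fin n → Bool, cylMeas μ w = 1 := by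
  simpa [measureReal_def, cylMeas] using
    sum_measureReal_inter_cylinder (μ := μ) n measurable_id Set.univ

lemma cylMeas_nonneg {n : ℕ} (w : Fin n → Bool) : 0 ≤ cylMeas μ w := ENNReal.toReal_nonneg

lemma cylMeas_le_one [IsProbabilityMeasure μ] {n : ℕ} (w : Fin n → Bool) : cylMeas μ w ≤ 1 :=
  measureReal_le_one

lemma shift_iterate_apply {E : Type} (m : ℕ) (x : ℕ → E) (i : ℕ) : shift^[m] x i = x (i + m) := by
  induction m generalizing x with
  | zero => rfl
  | succ m ih => simp [Function.iterate_succ, ih, shift, add_assoc]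

lemma subadditive_blockEntropy [IsProbabilityMeasure μ] (hμ : MeasurePreserving shift μ μ) :
    Subadditive (blockEntropy μ) := by
  intro m n
  have hset : ∀ (u : Fin m → Bool) (v : Fin n → Bool),
      {x : ℕ → Bool | ∀ i : Fin (m + n), x i.val = Fin.append u v i} =
        {x | ∀ i : Fin m, x i.val = u i} ∩
          shift^[m] ⁻¹' {x | ∀ i : Fin n, x i.val = v i} := by
    intro u v
    ext x
    simp [Fin.forall_fin_add, shift_iterate_apply, add_comm]
  have hms := hμ.iterate m
  unfold blockEntropy
  rw [← (Fin.appendEquiv m n).sum_comp]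
  refine sum_negMulLog_le_add (p := fun x => cylMeas μ (Fin.appendEquiv m n x))
    (fun x => cylMeas_nonneg _) (fun u => ?_) (fun v => ?_) (sum_cylMeas m) (sum_cylMeas n)
  · simp only [cylMeas, Fin.appendEquiv, Equiv.coe_fn_mk, hset]
    exact sum_measureReal_inter_cylinder n hms.measurable _
  · simp only [cylMeas, Fin.appendEquiv, Equiv.coe_fn_mk, hset]
    rw [← hms.measure_preimage (measurableSet_cylinder_word v).nullMeasurableSet]
    simp_rw [Set.inter_comm _ (shift^[m] ⁻¹' _)]
    exact sum_measureReal_inter_cylinder m measurable_id _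

lemma exists_tendsto_blockEntropy_div [IsProbabilityMeasure μ]
    (hμ : MeasurePreserving shift μ μ) :
    ∃ h : ℝ, Tendsto (fun n : ℕ => blockEntropy μ n / n) atTop (𝓝 h) :=
  ⟨_, (subadditive_blockEntropy hμ).tendsto_lim ⟨0, by
    rintro _ ⟨n, rfl⟩
    exact div_nonneg (Finset.sum_nonneg fun w _ =>
      negMulLog_nonneg (cylMeas_nonneg w) (cylMeas_le_one w)) n.cast_nonneg⟩⟩

/-- Jensen's inequality for `negMulLog`. -/
lemma integral_negMulLog_le {Ω : Type*} [MeasurableSpace Ω] {P : Measure Ω}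
    [IsProbabilityMeasure P] {q : Ω → ℝ} (hq : Measurable q) (h0 : ∀ y, 0 ≤ q y)
    (h1 : ∀ y, q y ≤ 1) :
    ∫ y, negMulLog (q y) ∂P ≤ negMulLog (∫ y, q y ∂P) := by
  refine concaveOn_negMulLog.le_map_integral continuous_negMulLog.continuousOn isClosed_Ici
    (.of_forall h0) (.of_bound hq.aestronglyMeasurable 1 (.of_forall fun y => ?_))
    (.of_bound (continuous_negMulLog.measurable.comp hq).aestronglyMeasurable 1
      (.of_forall fun y => ?_))
  · rw [norm_of_nonneg (h0 y)]
    exact h1 y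
  · rw [Function.comp_apply, norm_of_nonneg (negMulLog_nonneg (h0 y) (h1 y))]
    linarith [negMulLog_le_one_sub_self (h0 y), h0 y]

end Entropy

section Construction

open unitInterval

/-- A mark of size at most `coverThreshold j` covers the `j` preceding sites and its own. -/
noncomputable def coverThreshold (j : ℕ) : I :=
  ⟨1 / (8 * ((j : ℝ) + 1) ^ 2), by positivity, by
    rw [div_le_one (by positivity)]
    nlinarith [(j.cast_nonneg : (0 : ℝ) ≤ j)]⟩

lemma coverThreshold_antitone : Antitone coverThreshold := fun i j h => by
  rw [← Subtype.coe_le_coe]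
  simp only [coverThreshold]
  gcongr

/-- The sites covered by the marks `y`. -/
def covered (y : ℕ → I) : Set ℕ := {n | ∃ j, y (n + j) ≤ coverThreshold j}

open Classical in
/-- Overwrite the bits by `true` at all covered sites. -/
noncomputable def fillCovered (p : (ℕ → I) × (ℕ → Bool)) : ℕ → Bool :=
  fun n => if n ∈ covered p.1 then true else p.2 n

lemma fillCovered_semiconj : Function.Semiconj fillCovered (Prod.map shift shift) shift := by
  intro p
  funext n
  have h : n ∈ covered (shift p.1) ↔ n + 1 ∈ covered p.1 := by
    refine exists_congr fun j => ?_
    rw [shift, add_right_comm]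
  by_cases hc : n + 1 ∈ covered p.1
  · simp [fillCovered, h.2 hc, hc, show shift (fillCovered p) n = fillCovered p (n + 1) from rfl]
  · simp [fillCovered, mt h.1 hc, hc, shift]

lemma setOf_mem_covered (n : ℕ) : {y | n ∈ covered y} =
    ⋃ j, (fun y : ℕ → I => y (n + j)) ⁻¹' Set.Iic (coverThreshold j) := by
  ext y
  simp [covered]

lemma measurableSet_mem_covered (n : ℕ) : MeasurableSet {y | n ∈ covered y} := by
  rw [setOf_mem_covered]
  exact MeasurableSet.iUnion fun j => measurable_pi_apply (n + j) measurableSet_Iic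

lemma measurable_fillCovered : Measurable fillCovered :=
  measurable_pi_lambda _ fun n => Measurable.ite
    (measurable_fst (measurableSet_mem_covered n)) measurable_const (by fun_prop)

/-- The law of the i.i.d. uniform marks. -/
noncomputable abbrev markLaw : Measure (ℕ → I) := Measure.infinitePi fun _ => volume

/-- The law of the i.i.d. fair bits. -/
noncomputable abbrev bitLaw : Measure (ℕ → Bool) :=
  Measure.infinitePi fun _ => (PMF.uniformOfFintype Bool).toMeasure

/-- The law of the filled bit sequence. -/
noncomputable def fillLaw : Measure (ℕ → Bool) := (markLaw.prod bitLaw).map fillCovered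

instance : IsProbabilityMeasure fillLaw :=
  Measure.isProbabilityMeasure_map measurable_fillCovered.aemeasurable

lemma ergodic_shift_fillLaw : Ergodic shift fillLaw := by
  have h : MeasurePreserving fillCovered (markLaw.prod bitLaw) fillLaw :=
    ⟨measurable_fillCovered, rfl⟩
  have hs := ergodic_prodMap_shift_infinitePi (volume : Measure I)
    (PMF.uniformOfFintype Bool).toMeasure
  exact ⟨h.of_semiconj hs.toMeasurePreserving fillCovered_semiconj measurable_shift,
    h.preErgodic_of_preErgodic_semiconj hs.toPreErgodic fillCovered_semiconj⟩

lemma markLaw_le_coverThreshold (n j : ℕ) :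
    markLaw ((fun y => y n) ⁻¹' Set.Iic (coverThreshold j)) =
      ENNReal.ofReal (coverThreshold j) := by
  rw [(measurePreserving_eval_infinitePi (fun _ : ℕ => (volume : Measure I)) n).measure_preimage
    measurableSet_Iic.nullMeasurableSet, unitInterval.volume_Iic]

lemma markLaw_real_covered_le (n : ℕ) : markLaw.real {y | n ∈ covered y} ≤ 1 / 4 := by
  have hsum : HasSum (fun j => (coverThreshold j : ℝ)) (1 / 8 * (π ^ 2 / 6)) := by
    have h := ((hasSum_nat_add_iff' 1).2 hasSum_zeta_two).mul_left (1 / 8)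
    have hterm : (fun j => (coverThreshold j : ℝ)) =
        fun j : ℕ => 1 / 8 * (1 / ((j + 1 : ℕ) : ℝ) ^ 2) := by
      funext j
      simp [coverThreshold, mul_comm]
    rw [hterm]
    simpa using h
  refine ENNReal.toReal_le_of_le_ofReal (by norm_num) ?_
  calc markLaw {y | n ∈ covered y}
      ≤ ∑' j, markLaw ((fun y => y (n + j)) ⁻¹' Set.Iic (coverThreshold j)) := by
        rw [setOf_mem_covered]
        exact measure_iUnion_le _
    _ = ENNReal.ofReal (1 / 8 * (π ^ 2 / 6)) := by
        simp_rw [markLaw_le_coverThreshold]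
        rw [← ENNReal.ofReal_tsum_of_nonneg (fun j => (coverThreshold j).2.1) hsum.summable,
          hsum.tsum_eq]
    _ ≤ ENNReal.ofReal (1 / 4) :=
        ENNReal.ofReal_le_ofReal (by nlinarith [pi_lt_d2, pi_pos])

lemma coverThreshold_le_cylMeas_true (m : ℕ) :
    (coverThreshold m : ℝ) ≤ cylMeas fillLaw (fun _ : Fin (m + 1) => true) := by
  have hsub : (Prod.fst ⁻¹' ((fun y => y m) ⁻¹' Set.Iic (coverThreshold m)) :
      Set ((ℕ → I) × (ℕ → Bool))) ⊆
      fillCovered ⁻¹' {x | ∀ i : Fin (m + 1), x i.val = true} := by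
    intro p hp i
    have : i.val ∈ covered p.1 := by
      refine ⟨m - i.val, ?_⟩
      rw [Nat.add_sub_cancel' (Nat.lt_succ_iff.1 i.2)]
      exact le_trans hp (coverThreshold_antitone (Nat.sub_le _ _))
    simp [fillCovered, this]
  have h := measure_mono (μ := markLaw.prod bitLaw) hsub
  rw [measurePreserving_fst.measure_preimage
    (measurable_pi_apply m measurableSet_Iic).nullMeasurableSet, markLaw_le_coverThreshold,
    ← Measure.map_apply measurable_fillCovered (measurableSet_cylinder_word _)] at h
  exact (ENNReal.ofReal_le_iff_le_toReal (measure_ne_top fillLaw _)).1 h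

open Classical in
/-- The conditional probability, given the marks `y`, that the filled sequence starts with `w`. -/
noncomputable def condWordProb {n : ℕ} (w : Fin n → Bool) (y : ℕ → I) : ℝ :=
  ∏ i : Fin n, if i.val ∈ covered y then (if w i then 1 else 0) else 1 / 2

lemma bitLaw_real_fillCovered {n : ℕ} (w : Fin n → Bool) (y : ℕ → I) :
    bitLaw.real {b | ∀ i : Fin n, fillCovered (y, b) i.val = w i} = condWordProb w y := by
  classical
  let t : ℕ → Set Bool := fun k => if h : k < n then
    (if k ∈ covered y then (if w ⟨k, h⟩ then Set.univ else ∅) else {w ⟨k, h⟩}) else Set.univ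
  have hset : {b | ∀ i : Fin n, fillCovered (y, b) i.val = w i} =
      Set.pi (Finset.range n : Finset ℕ) t := by
    ext b
    simp only [Set.mem_ofPred_eq, Set.mem_pi, Finset.coe_range, Set.mem_Iio, Fin.forall_iff]
    refine forall₂_congr fun k hk => ?_
    by_cases hc : k ∈ covered y <;> by_cases hw : w ⟨k, hk⟩ <;> simp [t, fillCovered, hk, hc, hw]
  rw [measureReal_def, hset, Measure.infinitePi_pi _ fun i _ => Set.Finite.measurableSet
    (Set.toFinite _), ENNReal.toReal_prod, ← Fin.prod_univ_eq_prod_range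
    (fun k => ((PMF.uniformOfFintype Bool).toMeasure (t k)).toReal), condWordProb]
  refine Finset.prod_congr rfl fun i _ => ?_
  by_cases hc : i.val ∈ covered y <;> by_cases hw : w i <;>
    simp [t, hc, hw]

lemma measurable_condWordProb {n : ℕ} (w : Fin n → Bool) : Measurable (condWordProb w) :=
  Finset.measurable_fun_prod _ fun i _ =>
    Measurable.ite (measurableSet_mem_covered i.val) measurable_const measurable_const

lemma cylMeas_fillLaw {n : ℕ} (w : Fin n → Bool) :
    cylMeas fillLaw w = ∫ y, condWordProb w y ∂markLaw := by
  have hm := measurableSet_cylinder_word w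
  have hm' := measurable_fillCovered hm
  rw [cylMeas, fillLaw, Measure.map_apply measurable_fillCovered hm, Measure.prod_apply hm',
    ← integral_toReal (measurable_measure_prodMk_left hm').aemeasurable
      (.of_forall fun y => measure_lt_top _ _)]
  exact integral_congr_ae (.of_forall fun y => bitLaw_real_fillCovered w y)

lemma sum_condWordProb (n : ℕ) (y : ℕ → I) : ∑ w : Fin n → Bool, condWordProb w y = 1 := by
  classical
  unfold condWordProb
  rw [← Fintype.prod_sum (κ := fun _ => Bool) (f := fun (i : Fin n) (b : Bool) =>
    if i.val ∈ covered y then (if b then (1 : ℝ) else 0) else 1 / 2)]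
  refine Finset.prod_eq_one fun i _ => ?_
  by_cases hc : i.val ∈ covered y <;> simp [hc]

lemma condWordProb_nonneg {n : ℕ} (w : Fin n → Bool) (y : ℕ → I) : 0 ≤ condWordProb w y :=
  bitLaw_real_fillCovered w y ▸ measureReal_nonneg

lemma condWordProb_le_one {n : ℕ} (w : Fin n → Bool) (y : ℕ → I) : condWordProb w y ≤ 1 :=
  bitLaw_real_fillCovered w y ▸ measureReal_le_one

open Classical in
lemma negMulLog_condWordProb {n : ℕ} (w : Fin n → Bool) (y : ℕ → I) :
    negMulLog (condWordProb w y) =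
      condWordProb w y * ∑ i : Fin n, if i.val ∈ covered y then 0 else log 2 := by
  by_cases h0 : condWordProb w y = 0
  · simp [h0]
  rw [negMulLog, neg_mul, ← mul_neg]
  congr 1
  have hne := Finset.prod_ne_zero_iff.1 h0
  rw [condWordProb, log_prod hne, ← Finset.sum_neg_distrib]
  refine Finset.sum_congr rfl fun i hi => ?_
  have := hne i hi
  by_cases hc : i.val ∈ covered y <;> by_cases hw : w i <;> simp_all

lemma blockEntropy_fillLaw_ge (n : ℕ) : n * (3 / 4 * log 2) ≤ blockEntropy fillLaw n := by
  classical
  have hint : ∀ w : Fin n → Bool, Integrable (fun y => negMulLog (condWordProb w y)) markLaw :=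
    fun w => .of_bound (continuous_negMulLog.measurable.comp
      (measurable_condWordProb w)).aestronglyMeasurable 1 (.of_forall fun y => by
        rw [norm_of_nonneg (negMulLog_nonneg (condWordProb_nonneg w y) (condWordProb_le_one w y))]
        linarith [negMulLog_le_one_sub_self (condWordProb_nonneg w y), condWordProb_nonneg w y])
  have hind : ∀ i : ℕ, (fun y => if i ∈ covered y then (0 : ℝ) else log 2) =
      {y | i ∈ covered y}ᶜ.indicator fun _ => log 2 := by
    intro i
    funext y
    by_cases hc : i ∈ covered y <;> simp [hc]
  calc n * (3 / 4 * log 2)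
      = ∑ i : Fin n, 3 / 4 * log 2 := by simp
    _ ≤ ∑ i : Fin n, ∫ y, (if i.val ∈ covered y then 0 else log 2) ∂markLaw := by
        refine Finset.sum_le_sum fun i _ => ?_
        rw [hind, integral_indicator_const _ (measurableSet_mem_covered _).compl,
          probReal_compl_eq_one_sub (measurableSet_mem_covered _), smul_eq_mul]
        exact mul_le_mul_of_nonneg_right (by linarith [markLaw_real_covered_le i.val])
          (log_nonneg one_le_two)
    _ = ∫ y, ∑ i : Fin n, (if i.val ∈ covered y then 0 else log 2) ∂markLaw := by
        refine (integral_finsetSum _ fun i _ => ?_).symm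
        rw [hind]
        exact (integrable_const _).indicator (measurableSet_mem_covered _).compl
    _ = ∫ y, ∑ w : Fin n → Bool, negMulLog (condWordProb w y) ∂markLaw := by
        simp_rw [negMulLog_condWordProb, ← Finset.sum_mul, sum_condWordProb, one_mul]
    _ = ∑ w : Fin n → Bool, ∫ y, negMulLog (condWordProb w y) ∂markLaw :=
        integral_finsetSum _ fun w _ => hint w
    _ ≤ blockEntropy fillLaw n := by
        refine Finset.sum_le_sum fun w _ => ?_
        rw [cylMeas_fillLaw]
        exact integral_negMulLog_le (measurable_condWordProb w) (condWordProb_nonneg w)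
          (condWordProb_le_one w)

end Construction

lemma tendsto_log_inverse_square_div :
    Tendsto (fun m : ℕ => log (1 / (8 * (m : ℝ) ^ 2)) / m) atTop (𝓝 0) := by
  have h1 : Tendsto (fun m : ℕ => log (m : ℝ) / m) atTop (𝓝 0) :=
    (by simpa using isLittleO_log_id_atTop.tendsto_div_nhds_zero :
      Tendsto (fun x : ℝ => log x / x) atTop (𝓝 0)).comp tendsto_natCast_atTop_atTop
  have h2 : Tendsto (fun m : ℕ => log 8 / (m : ℝ)) atTop (𝓝 0) :=
    tendsto_const_div_atTop_nhds_zero_nat _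
  have h3 := (h2.add (h1.const_mul 2)).neg
  simp only [mul_zero, add_zero, neg_zero] at h3
  refine h3.congr' ?_
  filter_upwards [eventually_gt_atTop 0] with m hm
  have hm' : (m : ℝ) ≠ 0 := by positivity
  rw [one_div, log_inv, log_mul (by norm_num) (by positivity), log_pow]
  push_cast
  ring

/-- There is a stationary ergodic binary process whose probability of `m` consecutive ones
decays subexponentially, yet whose Shannon entropy rate (in bits) exceeds `1/2`. -/
theorem exists_ergodic_process_subexponential_ones_and_large_entropy :
    ∃ (μ : Measure (ℕ → Bool)) (αseq : ℕ → ℝ),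
      IsProbabilityMeasure μ ∧ Ergodic shift μ ∧
      (∀ m : ℕ, 1 ≤ m → 0 < αseq m) ∧
      Tendsto (fun m : ℕ => Real.log (αseq m) / m) atTop (nhds 0) ∧
      (∀ m : ℕ, 1 ≤ m → αseq m ≤ cylMeas μ (fun _ : Fin m => true)) ∧
      ∃ h : ℝ, 1 / 2 < h ∧
        Tendsto
          (fun n : ℕ =>
            (-∑ w : Fin n → Bool, cylMeas μ w * Real.logb 2 (cylMeas μ w)) / n)
          atTop (nhds h) := by
  refine ⟨fillLaw, fun m => 1 / (8 * (m : ℝ) ^ 2), inferInstance, ergodic_shift_fillLaw,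
    fun m hm => by positivity, tendsto_log_inverse_square_div, fun m hm => ?_, ?_⟩
  · obtain ⟨k, rfl⟩ := Nat.exists_eq_add_of_le' hm
    simpa [coverThreshold] using coverThreshold_le_cylMeas_true k
  obtain ⟨h, hh⟩ := exists_tendsto_blockEntropy_div ergodic_shift_fillLaw.toMeasurePreserving
  have hlog : 0 < log 2 := log_pos one_lt_two
  have hge : 3 / 4 * log 2 ≤ h := by
    refine ge_of_tendsto hh ?_
    filter_upwards [eventually_gt_atTop 0] with n hn
    rw [le_div_iff₀ (by positivity), mul_comm]
    exact blockEntropy_fillLaw_ge n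
  refine ⟨h / log 2, ?_, (hh.div_const (log 2)).congr fun n => ?_⟩
  · rw [lt_div_iff₀ hlog]
    linarith
  · simp only [blockEntropy, negMulLog, logb, neg_mul, Finset.sum_neg_distrib, ← mul_div_assoc,
      ← Finset.sum_div]
    ring
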